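/- Let V ⊆ ℝ² be open and convex, and let X, T : V → M₂(ℝ) be smooth 2×2-matrix-valued functions satisfying the zero-curvature equation ∂ₜX − ∂ₓT + (X·T − T·X) = 0 on V. Then for every p ∈ V and every v₀ ∈ ℝ² there exists a smooth function v : V → ℝ² with v(p) = v₀ such that ∂ₓv = X·v and ∂ₜv = T·v on V. -/

import Mathlib

open Real

/-- Partial derivative with respect to the first coordinate `x` of `ℝ × ℝ`. -/
noncomputable def pdx (f : ℝ × ℝ → ℝ) (p : ℝ × ℝ) : ℝ := fderiv ℝ f p (1, 0)

/-- Partial derivative with respect to the second coordinate `t` of `ℝ × ℝ`. -/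
noncomputable def pdt (f : ℝ × ℝ → ℝ) (p : ℝ × ℝ) : ℝ := fderiv ℝ f p (0, 1)

/-- The coefficients `f_{αβ}` of the one-forms `ω^α = f_{α1} dx + f_{α2} dt` satisfy the
structure equations of a pseudo-spherical surface on `V`:
`dω¹ = ω³ ∧ ω², dω² = ω¹ ∧ ω³, dω³ = ω¹ ∧ ω²`. -/
def StructEq (V : Set (ℝ × ℝ)) (f11 f12 f21 f22 f31 f32 : ℝ × ℝ → ℝ) : Prop :=
  ∀ p ∈ V,
    pdx f12 p - pdt f11 p = f31 p * f22 p - f32 p * f21 p ∧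
    pdx f22 p - pdt f21 p = f11 p * f32 p - f12 p * f31 p ∧
    pdx f32 p - pdt f31 p = f11 p * f22 p - f12 p * f21 p

open Set Filter Topology

/-- Truncation of each coordinate of a vector to `[-R, R]`. -/
def coordClamp {ι : Type*} (R : ℝ) (x : ι → ℝ) : ι → ℝ := fun i => max (-R) (min R (x i))

section LinearODE

variable {ι : Type*} [Fintype ι]

lemma lipschitzWith_coordClamp (R : ℝ) :
    LipschitzWith 1 (coordClamp R : (ι → ℝ) → ι → ℝ) := by
  refine LipschitzWith.of_dist_le_mul fun x y => ?_
  rw [NNReal.coe_one, one_mul, dist_pi_le_iff dist_nonneg]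
  intro i
  have h : LipschitzWith 1 fun t : ℝ => max (-R) (min R t) :=
    (LipschitzWith.id.const_min R).const_max (-R)
  have hi := h.dist_le_mul (x i) (y i)
  rw [NNReal.coe_one, one_mul] at hi
  exact hi.trans (dist_le_pi_dist x y i)

lemma norm_coordClamp_le {R : ℝ} (hR : 0 ≤ R) (x : ι → ℝ) : ‖coordClamp R x‖ ≤ R := by
  refine (pi_norm_le_iff_of_nonneg hR).2 fun i => abs_le.2 ⟨le_max_left _ _, ?_⟩
  exact max_le (by linarith) (min_le_left _ _)

lemma norm_coordClamp_le_norm {R : ℝ} (hR : 0 ≤ R) (x : ι → ℝ) : ‖coordClamp R x‖ ≤ ‖x‖ := by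
  have h0 : coordClamp R (0 : ι → ℝ) = 0 := by
    funext i
    simp [coordClamp, hR]
  simpa [h0] using (lipschitzWith_coordClamp (ι := ι) R).dist_le_mul x 0

lemma coordClamp_eq_self {R : ℝ} {x : ι → ℝ} (hx : ‖x‖ ≤ R) : coordClamp R x = x := by
  funext i
  obtain ⟨h1, h2⟩ := abs_le.1 ((norm_le_pi_norm x i).trans hx)
  simp [coordClamp, h1, h2]

lemma HasDerivWithinAt.Ici_of_Icc {E : Type*} [NormedAddCommGroup E] [NormedSpace ℝ E]
    {f : ℝ → E} {f' : E} {a b s : ℝ} (hs : s ∈ Ico a b)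
    (h : HasDerivWithinAt f f' (Icc a b) s) : HasDerivWithinAt f f' (Ici s) s :=
  h.mono_of_mem_nhdsWithin
    (mem_of_superset (Icc_mem_nhdsGE hs.2) (Icc_subset_Icc_left hs.1))

/-- A linear ODE with continuous coefficients is solvable on all of `[0, 1]`. -/
theorem exists_hasDerivWithinAt_linear {B : ℝ → (ι → ℝ) →L[ℝ] (ι → ℝ)}
    (hB : ContinuousOn B (Icc 0 1)) (v₀ : ι → ℝ) :
    ∃ w : ℝ → ι → ℝ, w 0 = v₀ ∧
      ∀ s ∈ Icc (0 : ℝ) 1, HasDerivWithinAt w (B s (w s)) (Icc 0 1) s := by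
  obtain ⟨K, hK⟩ := isCompact_Icc.exists_bound_of_continuousOn hB
  have hK0 : 0 ≤ K := (norm_nonneg _).trans (hK 0 (by simp))
  set R : ℝ := ‖v₀‖ * Real.exp K with hR
  have hR0 : 0 ≤ R := by positivity
  have hPL : IsPicardLindelof (fun s x => B s (coordClamp R x))
      (⟨0, by simp⟩ : Icc (0 : ℝ) 1) v₀ ⟨K * R, by positivity⟩ 0 ⟨K * R, by positivity⟩
      ⟨K, hK0⟩ := by
    refine ⟨fun t ht => LipschitzWith.lipschitzOnWith ?_, fun x _ => ?_, fun t ht x _ => ?_, ?_⟩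
    · refine LipschitzWith.of_dist_le_mul fun x y => ?_
      have h1 := (lipschitzWith_coordClamp R).dist_le_mul x y
      rw [NNReal.coe_one, one_mul, dist_eq_norm] at h1
      rw [dist_eq_norm, ← map_sub]
      exact (B t).le_of_opNorm_le_of_le (hK t ht) h1
    · exact hB.clm_apply continuousOn_const
    · exact (B t).le_of_opNorm_le_of_le (hK t ht) (norm_coordClamp_le hR0 x)
    · simp
  obtain ⟨w, hw0, hw⟩ := hPL.exists_eq_forall_mem_Icc_hasDerivWithinAt₀
  have hbound : ∀ s ∈ Icc (0 : ℝ) 1, ‖w s‖ ≤ R := by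
    intro s hs
    have := norm_le_gronwallBound_of_norm_deriv_right_le (f := w) (δ := ‖v₀‖) (K := K) (ε := 0)
      (fun s hs => (hw s hs).continuousWithinAt)
      (fun s hs => (hw s (Ico_subset_Icc_self hs)).Ici_of_Icc hs) (congrArg norm hw0).le
      (fun s hs => by
        rw [add_zero]
        exact (B s).le_of_opNorm_le_of_le (hK s (Ico_subset_Icc_self hs))
          (norm_coordClamp_le_norm hR0 _)) s hs
    rw [gronwallBound_ε0] at this
    refine this.trans ?_
    rw [hR]
    gcongr
    nlinarith [hs.1, hs.2]
  refine ⟨w, hw0, fun s hs => ?_⟩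
  simpa only [coordClamp_eq_self (hbound s hs)] using hw s hs

end LinearODE

section FlatConnection

set_option maxSynthPendingDepth 3

variable {F : Type*} [NormedAddCommGroup F] [NormedSpace ℝ F]

/-- A `C¹` map is uniformly differentiable along a compact set. -/
lemma IsCompact.eventually_norm_sub_sub_fderiv_le {G : Type*} [NormedAddCommGroup G]
    [NormedSpace ℝ G] {V S : Set F} (hV : IsOpen V) {A : F → G} (hA : ContDiffOn ℝ 1 A V)
    (hS : IsCompact S) (hSV : S ⊆ V) {ε : ℝ} (hε : 0 < ε) :
    ∀ᶠ k in 𝓝 (0 : F), ∀ y ∈ S, ‖A (y + k) - A y - fderiv ℝ A y k‖ ≤ ε * ‖k‖ := by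
  refine hS.eventually_forall_of_forall_eventually fun y hy => ?_
  have hyV := hV.mem_nhds (hSV hy)
  have h1 := ((hA.contDiffAt hyV).hasStrictFDerivAt one_ne_zero).isLittleO.def (half_pos hε)
  have h2 : Tendsto (fun z : F × F => (z.2 + z.1, z.2)) (𝓝 (0, y)) (𝓝 (y, y)) := by
    have : Continuous fun z : F × F => (z.2 + z.1, z.2) := by fun_prop
    simpa using this.tendsto (0, y)
  have h3 : ∀ᶠ x in 𝓝 y, ‖fderiv ℝ A x - fderiv ℝ A y‖ < ε / 2 := by
    have := ((hA.continuousOn_fderiv_of_isOpen hV le_rfl).continuousAt hyV)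
    simpa [dist_eq_norm] using Metric.tendsto_nhds.1 this (ε / 2) (half_pos hε)
  have h4 : Tendsto (fun z : F × F => z.2) (𝓝 (0, y)) (𝓝 y) := continuous_snd.tendsto (0, y)
  filter_upwards [h2.eventually h1, h4.eventually h3] with z hz1 hz2
  have h5 : A (z.2 + z.1) - A z.2 - fderiv ℝ A z.2 z.1 =
      (A (z.2 + z.1) - A z.2 - fderiv ℝ A y (z.2 + z.1 - z.2))
        - (fderiv ℝ A z.2 - fderiv ℝ A y) z.1 := by
    simp
  rw [h5]
  refine (norm_sub_le _ _).trans ?_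
  have h6 := (fderiv ℝ A z.2 - fderiv ℝ A y).le_of_opNorm_le hz2.le z.1
  simp only [add_sub_cancel_left] at hz1 ⊢
  linarith

variable {E : Type*} [NormedAddCommGroup E] [NormedSpace ℝ E]

lemma hasDerivWithinAt_smul_connection_apply {A : F → F →L[ℝ] E →L[ℝ] E}
    {D : F →L[ℝ] F →L[ℝ] E →L[ℝ] E} {γ : ℝ → F} {e : F} {u : ℝ → E} {u' : E} {I : Set ℝ} {s : ℝ}
    (hA : HasFDerivAt A D (γ s)) (hγ : HasDerivWithinAt γ e I s) (hu : HasDerivWithinAt u u' I s)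
    (h : F) :
    HasDerivWithinAt (fun r => r • A (γ r) h (u r))
      (s • (D e h (u s) + A (γ s) h u') + A (γ s) h (u s)) I s := by
  have h1 : HasDerivWithinAt (fun r => A (γ r)) (D e) I s := hA.comp_hasDerivWithinAt s hγ
  have h2 : HasDerivWithinAt (fun r => A (γ r) h) (D e h) I s := by
    simpa using h1.clm_apply (hasDerivWithinAt_const s I h)
  simpa using (hasDerivWithinAt_id s I).fun_smul (h2.clm_apply hu)

/-- The growth of the difference between a radially transported vector `w` at a displaced point
and the first-order prediction `u + s • A₀ h u`. -/
lemma norm_deviation_deriv_le {A₀ A₁ : F →L[ℝ] E →L[ℝ] E} {D : F →L[ℝ] F →L[ℝ] E →L[ℝ] E}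
    {e h : F} {u w : E} {s d ε M₁ M₂ W : ℝ} (hs : s ∈ Icc (0 : ℝ) 1)
    (hflat : D e h u + A₀ h (A₀ e u) = D h e u + A₀ e (A₀ h u))
    (he : ‖e‖ ≤ d) (h_one : ‖h‖ ≤ 1) (h_eps : ‖h‖ ≤ ε) (hu : ‖u‖ ≤ W)
    (hA₀ : ‖A₀‖ ≤ M₁) (hD : ‖D‖ ≤ M₂)
    (hR₁ : ‖A₁ - A₀ - D (s • h)‖ ≤ ε * ‖h‖) (hR₂ : ‖A₁ - A₀ - D (s • h)‖ ≤ 1 * ‖h‖) :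
    ‖A₁ (e + h) w - A₀ e u - (s • (D e h u + A₀ h (A₀ e u)) + A₀ h u)‖ ≤
      (M₁ + M₂ + 1) * (d + 1) * ‖w - u - s • A₀ h u‖
        + ε * (((M₁ + M₂ + 1) * (d + 1) * M₁ + d + M₂ + 1) * W) * ‖h‖ := by
  have hM₁ : 0 ≤ M₁ := (norm_nonneg _).trans hA₀
  have hM₂ : 0 ≤ M₂ := (norm_nonneg _).trans hD
  have hW : 0 ≤ W := (norm_nonneg _).trans hu
  have hd : 0 ≤ d := (norm_nonneg _).trans he
  have hsh : ‖s • h‖ ≤ ‖h‖ := by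
    rw [norm_smul, Real.norm_of_nonneg hs.1]
    exact mul_le_of_le_one_left (norm_nonneg _) hs.2
  have hL : ‖A₁ - A₀‖ ≤ (M₂ + 1) * ‖h‖ := by
    have h2 := D.le_of_opNorm_le_of_le hD hsh
    have h3 := norm_le_norm_sub_add (A₁ - A₀) (D (s • h))
    linarith
  have hdh : ‖e + h‖ ≤ d + 1 := (norm_add_le _ _).trans (by linarith)
  set K := (M₁ + M₂ + 1) * (d + 1) with hK
  have hB : ‖A₁ (e + h)‖ ≤ K := by
    have h1 : ‖A₁‖ ≤ M₁ + M₂ + 1 := by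
      have := norm_le_norm_sub_add A₁ A₀
      nlinarith
    exact A₁.le_of_opNorm_le_of_le h1 hdh
  have hAh : ‖A₀ h‖ ≤ M₁ * ‖h‖ := A₀.le_of_opNorm_le hA₀ h
  have hBB : ‖A₁ (e + h) - A₀ e‖ ≤ K * ‖h‖ := by
    have h1 : A₁ (e + h) - A₀ e = (A₁ - A₀) (e + h) + A₀ h := by
      rw [sub_apply, map_add A₀]
      abel
    have h2 := (A₁ - A₀).le_of_opNorm_le_of_le hL hdh
    rw [h1]
    refine (norm_add_le _ _).trans ?_
    have h3 : 0 ≤ M₁ * d * ‖h‖ := by positivity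
    rw [hK]
    linarith
  have hdecomp : A₁ (e + h) w - A₀ e u - (s • (D e h u + A₀ h (A₀ e u)) + A₀ h u)
      = A₁ (e + h) (w - u - s • A₀ h u)
        + (s • (A₁ (e + h) - A₀ e) (A₀ h u)
        + ((A₁ - A₀ - D (s • h)) e u + (A₁ - A₀) h u)) := by
    rw [hflat]
    simp only [map_sub, map_add, map_smul, sub_apply, add_apply, smul_apply, smul_add, smul_sub]
    abel
  rw [hdecomp]
  have e1 := (A₁ (e + h)).le_of_opNorm_le hB (w - u - s • A₀ h u)
  have e2 : ‖s • (A₁ (e + h) - A₀ e) (A₀ h u)‖ ≤ K * ‖h‖ * (M₁ * ‖h‖ * W) := by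
    rw [norm_smul, Real.norm_of_nonneg hs.1]
    refine (mul_le_of_le_one_left (norm_nonneg _) hs.2).trans ?_
    exact ContinuousLinearMap.le_of_opNorm_le_of_le _ hBB
      (ContinuousLinearMap.le_of_opNorm_le_of_le _ hAh hu)
  have e3 := ContinuousLinearMap.le_of_opNorm_le_of_le _
    (ContinuousLinearMap.le_of_opNorm_le_of_le _ hR₁ he) hu
  have e4 := ContinuousLinearMap.le_of_opNorm_le_of_le _
    (ContinuousLinearMap.le_of_opNorm_le _ hL h) hu
  have e5 : K * ‖h‖ * (M₁ * ‖h‖ * W) + (ε * ‖h‖ * d * W + (M₂ + 1) * ‖h‖ * ‖h‖ * W)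
      ≤ ε * ((K * M₁ + d + M₂ + 1) * W) * ‖h‖ := by
    have hK0 : 0 ≤ K := by positivity
    calc _ = ‖h‖ * ((K * M₁ + M₂ + 1) * W * ‖h‖) + ε * ‖h‖ * d * W := by ring
      _ ≤ ‖h‖ * ((K * M₁ + M₂ + 1) * W * ε) + ε * ‖h‖ * d * W := by gcongr
      _ = ε * ((K * M₁ + d + M₂ + 1) * W) * ‖h‖ := by ring
  refine (norm_add_le _ _).trans (add_le_add e1 (le_trans ?_ e5))
  exact (norm_add_le _ _).trans (add_le_add e2 ((norm_add_le _ _).trans (add_le_add e3 e4)))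

variable {ι : Type*} [Fintype ι]

/-- A flat linear connection on a convex open set has covariantly constant sections through
every initial value. -/
theorem exists_hasFDerivAt_of_flat {V : Set F} (hV : IsOpen V) (hconv : Convex ℝ V)
    {A : F → F →L[ℝ] (ι → ℝ) →L[ℝ] (ι → ℝ)} (hA : ContDiffOn ℝ 1 A V)
    (hflat : ∀ x ∈ V, ∀ (h k : F) (u : ι → ℝ),
      fderiv ℝ A x h k u + A x k (A x h u) = fderiv ℝ A x k h u + A x h (A x k u))
    {p : F} (hp : p ∈ V) (v₀ : ι → ℝ) :
    ∃ v : F → ι → ℝ, v p = v₀ ∧ ∀ x ∈ V, HasFDerivAt v ((A x).flip (v x)) x := by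
  have hγ : ∀ q ∈ V, ∀ s ∈ Icc (0 : ℝ) 1, p + s • (q - p) ∈ V := fun q hq s hs =>
    hconv.add_smul_sub_mem hp hq hs
  have hex : ∀ q, ∃ w : ℝ → ι → ℝ, q ∈ V → w 0 = v₀ ∧ ∀ s ∈ Icc (0 : ℝ) 1,
      HasDerivWithinAt w (A (p + s • (q - p)) (q - p) (w s)) (Icc 0 1) s := by
    intro q
    by_cases hq : q ∈ V
    · obtain ⟨w, hw⟩ := exists_hasDerivWithinAt_linear
        (B := fun s => A (p + s • (q - p)) (q - p))
        ((hA.continuousOn.comp (by fun_prop) (hγ q hq)).clm_apply continuousOn_const) v₀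
      exact ⟨w, fun _ => hw⟩
    · exact ⟨0, fun h => absurd h hq⟩
  choose w hw using hex
  refine ⟨fun q => w q 1, ?_, fun q hq => ?_⟩
  · obtain ⟨h0, h1⟩ := hw p hp
    rw [← h0]
    refine constant_of_has_deriv_right_zero (fun s hs => (h1 s hs).continuousWithinAt)
      (fun s hs => ?_) 1 (by simp)
    simpa using (h1 s (Ico_subset_Icc_self hs)).Ici_of_Icc hs
  obtain ⟨hq0, hq1⟩ := hw q hq
  set γ : ℝ → F := fun s => p + s • (q - p) with hγdef
  have hγc : Continuous γ := by fun_prop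
  set S : Set F := γ '' Icc 0 1 with hSdef
  have hS : IsCompact S := isCompact_Icc.image hγc
  have hSV : S ⊆ V := by
    rintro _ ⟨s, hs, rfl⟩
    exact hγ q hq s hs
  obtain ⟨M₁, hM₁⟩ := hS.exists_bound_of_continuousOn (hA.continuousOn.mono hSV)
  obtain ⟨M₂, hM₂⟩ := hS.exists_bound_of_continuousOn
    ((hA.continuousOn_fderiv_of_isOpen hV le_rfl).mono hSV)
  obtain ⟨W, hW⟩ := isCompact_Icc.exists_bound_of_continuousOn
    (fun s hs => (hq1 s hs).continuousWithinAt : ContinuousOn (w q) (Icc 0 1))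
  have hmem0 : γ 0 ∈ S := ⟨0, by simp, rfl⟩
  have hM₁0 : 0 ≤ M₁ := (norm_nonneg _).trans (hM₁ _ hmem0)
  have hM₂0 : 0 ≤ M₂ := (norm_nonneg _).trans (hM₂ _ hmem0)
  have hW0 : 0 ≤ W := (norm_nonneg _).trans (hW 0 (by simp))
  set d := ‖q - p‖ with hd
  have hd0 : 0 ≤ d := norm_nonneg _
  set K := (M₁ + M₂ + 1) * (d + 1) with hKdef
  have hK0 : 0 < K := by positivity
  set C := (K * M₁ + d + M₂ + 1) * W with hC
  have hC0 : 0 ≤ C := by positivity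
  set G := (Real.exp K - 1) / K with hG
  have hG0 : 0 ≤ G := div_nonneg (by linarith [Real.add_one_le_exp K]) hK0.le
  rw [hasFDerivAt_iff_isLittleO_nhds_zero, Asymptotics.isLittleO_iff]
  intro c hc
  set ε := c / (C * G + 1) with hεdef
  have hε : 0 < ε := by positivity
  obtain ⟨δ₁, hδ₁, hU₁⟩ := Metric.eventually_nhds_iff_ball.1
    (hS.eventually_norm_sub_sub_fderiv_le hV hA hSV hε)
  obtain ⟨δ₂, hδ₂, hU₂⟩ := Metric.eventually_nhds_iff_ball.1
    (hS.eventually_norm_sub_sub_fderiv_le hV hA hSV one_pos)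
  have hVq : ∀ᶠ h in 𝓝 (0 : F), q + h ∈ V := by
    have : Tendsto (fun h : F => q + h) (𝓝 0) (𝓝 q) := by
      have hc : Continuous fun h : F => q + h := by fun_prop
      simpa using hc.tendsto 0
    exact this.eventually (hV.mem_nhds hq)
  filter_upwards [hVq, Metric.ball_mem_nhds (0 : F) hδ₁, Metric.ball_mem_nhds (0 : F) hδ₂,
    Metric.ball_mem_nhds (0 : F) one_pos, Metric.ball_mem_nhds (0 : F) hε] with h hhV hh₁ hh₂ hh₃ hh₄
  obtain ⟨hr0, hr1⟩ := hw (q + h) hhV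
  rw [mem_ball_zero_iff] at hh₁ hh₂ hh₃ hh₄
  have hqh : q + h - p = q - p + h := by abel
  have hγh : ∀ s : ℝ, p + s • (q - p + h) = γ s + s • h := fun s => by
    simp only [hγdef, smul_add]; abel
  simp only [hqh, hγh] at hr1
  set z : ℝ → ι → ℝ := fun s => w (q + h) s - w q s - s • A (γ s) h (w q s) with hz
  set z' : ℝ → ι → ℝ := fun s => A (γ s + s • h) (q - p + h) (w (q + h) s)
    - A (γ s) (q - p) (w q s)
    - (s • (fderiv ℝ A (γ s) (q - p) h (w q s) + A (γ s) h (A (γ s) (q - p) (w q s)))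
      + A (γ s) h (w q s)) with hz'
  have hzd : ∀ s ∈ Icc (0 : ℝ) 1, HasDerivWithinAt z (z' s) (Icc 0 1) s := by
    intro s hs
    have hγd : HasDerivAt γ (q - p) s := by
      have := ((hasDerivAt_id s).smul_const (q - p)).const_add p
      rwa [one_smul] at this
    have hAd : HasFDerivAt A (fderiv ℝ A (γ s)) (γ s) :=
      ((hA.contDiffAt (hV.mem_nhds (hγ q hq s hs))).differentiableAt one_ne_zero).hasFDerivAt
    exact ((hr1 s hs).sub (hq1 s hs)).sub
      (hasDerivWithinAt_smul_connection_apply hAd hγd.hasDerivWithinAt (hq1 s hs) h)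
  have hzb : ∀ s ∈ Icc (0 : ℝ) 1, ‖z' s‖ ≤ K * ‖z s‖ + ε * C * ‖h‖ := by
    intro s hs
    have hsS : γ s ∈ S := ⟨s, hs, rfl⟩
    have hsh : ‖s • h‖ ≤ ‖h‖ := by
      rw [norm_smul, Real.norm_of_nonneg hs.1]
      exact mul_le_of_le_one_left (norm_nonneg _) hs.2
    exact norm_deviation_deriv_le hs (hflat (γ s) (hSV hsS) (q - p) h (w q s)) le_rfl hh₃.le
      hh₄.le (hW s hs) (hM₁ _ hsS) (hM₂ _ hsS)
      ((hU₁ _ (mem_ball_zero_iff.2 (hsh.trans_lt hh₁)) _ hsS).trans (by gcongr))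
      ((hU₂ _ (mem_ball_zero_iff.2 (hsh.trans_lt hh₂)) _ hsS).trans (by gcongr))
  have hfin := norm_le_gronwallBound_of_norm_deriv_right_le (f := z) (δ := 0) (K := K)
    (ε := ε * C * ‖h‖) (fun s hs => (hzd s hs).continuousWithinAt)
    (fun s hs => (hzd s (Ico_subset_Icc_self hs)).Ici_of_Icc hs) (by simp [hz, hr0, hq0])
    (fun s hs => hzb s (Ico_subset_Icc_self hs)) 1 (by simp)
  rw [gronwallBound_of_K_ne_0 hK0.ne'] at hfin
  have hz1 : z 1 = w (q + h) 1 - w q 1 - (A q).flip (w q 1) h := by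
    simp [hz, hγdef]
  rw [← hz1]
  refine hfin.trans ?_
  calc _ = ε * (C * G) * ‖h‖ := by simp only [hG]; ring_nf
    _ ≤ ε * (C * G + 1) * ‖h‖ := by gcongr; linarith
    _ = c * ‖h‖ := by rw [hεdef, div_mul_cancel₀]; positivity

/-- Covariantly constant sections of a smooth connection are smooth. -/
lemma contDiffOn_of_hasFDerivAt_flip {V : Set F} (hV : IsOpen V)
    {A : F → F →L[ℝ] E →L[ℝ] E} (hA : ContDiffOn ℝ (⊤ : ℕ∞) A V)
    {v : F → E} (hv : ∀ x ∈ V, HasFDerivAt v ((A x).flip (v x)) x) :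
    ContDiffOn ℝ (⊤ : ℕ∞) v V := by
  refine contDiffOn_infty.2 fun n => ?_
  induction n with
  | zero => exact contDiffOn_zero.2 fun x hx => (hv x hx).continuousAt.continuousWithinAt
  | succ n ih =>
    push_cast
    refine (contDiffOn_succ_iff_fderiv_of_isOpen hV).2
      ⟨fun x hx => (hv x hx).differentiableAt.differentiableWithinAt, by simp, ?_⟩
    refine ContDiffOn.congr ?_ fun x hx => (hv x hx).fderiv
    have hAf : ContDiffOn ℝ n (fun x => (A x).flip) V :=
      (ContinuousLinearMap.flipₗᵢ ℝ F E E).contDiff.comp_contDiffOn (contDiffOn_infty.1 hA n)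
    exact hAf.clm_apply ih

end FlatConnection

section MatrixPair

/-- The continuous linear map of a `2 × 2` matrix with entries `a i j`. -/
noncomputable def entriesCLM (a : Fin 2 → Fin 2 → ℝ) : (Fin 2 → ℝ) →L[ℝ] (Fin 2 → ℝ) :=
  ∑ i, ∑ j, a i j • (ContinuousLinearMap.proj (R := ℝ) (φ := fun _ : Fin 2 => ℝ) j).smulRight
    (Pi.single i (1 : ℝ) : Fin 2 → ℝ)

lemma entriesCLM_apply (a : Fin 2 → Fin 2 → ℝ) (u : Fin 2 → ℝ) (i : Fin 2) :
    entriesCLM a u i = ∑ j, a i j * u j := by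
  fin_cases i <;> simp [entriesCLM, Fin.sum_univ_two]

/-- The connection form `X dx + T dt` on `ℝ × ℝ`. -/
noncomputable def connectionForm (X T : Fin 2 → Fin 2 → ℝ) :
    ℝ × ℝ →L[ℝ] (Fin 2 → ℝ) →L[ℝ] (Fin 2 → ℝ) :=
  (ContinuousLinearMap.fst ℝ ℝ ℝ).smulRight (entriesCLM X)
    + (ContinuousLinearMap.snd ℝ ℝ ℝ).smulRight (entriesCLM T)

lemma connectionForm_apply (X T : Fin 2 → Fin 2 → ℝ) (h : ℝ × ℝ) (u : Fin 2 → ℝ) (i : Fin 2) :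
    connectionForm X T h u i = h.1 * ∑ j, X i j * u j + h.2 * ∑ j, T i j * u j := by
  simp [connectionForm, entriesCLM_apply]

lemma fderiv_apply_eq_pd (f : ℝ × ℝ → ℝ) (q h : ℝ × ℝ) :
    fderiv ℝ f q h = h.1 * pdx f q + h.2 * pdt f q := by
  have : h = h.1 • ((1, 0) : ℝ × ℝ) + h.2 • ((0, 1) : ℝ × ℝ) := by ext <;> simp
  conv_lhs => rw [this, map_add, map_smul, map_smul]
  rfl

variable {V : Set (ℝ × ℝ)} {X T : ℝ × ℝ → Fin 2 → Fin 2 → ℝ}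

lemma contDiffOn_connectionForm {n : WithTop ℕ∞}
    (hX : ∀ i j, ContDiffOn ℝ n (fun p => X p i j) V)
    (hT : ∀ i j, ContDiffOn ℝ n (fun p => T p i j) V) :
    ContDiffOn ℝ n (fun q => connectionForm (X q) (T q)) V := by
  have key : ∀ Y : ℝ × ℝ → Fin 2 → Fin 2 → ℝ, (∀ i j, ContDiffOn ℝ n (fun p => Y p i j) V) →
      ContDiffOn ℝ n (fun q => entriesCLM (Y q)) V := fun Y hY =>
    ContDiffOn.sum fun i _ => ContDiffOn.sum fun j _ => (hY i j).smul contDiffOn_const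
  exact (contDiffOn_const.smulRight (key X hX)).add (contDiffOn_const.smulRight (key T hT))

lemma fderiv_connectionForm_apply (hV : IsOpen V)
    (hX : ∀ i j, ContDiffOn ℝ 1 (fun p => X p i j) V)
    (hT : ∀ i j, ContDiffOn ℝ 1 (fun p => T p i j) V) {q : ℝ × ℝ} (hq : q ∈ V)
    (h k : ℝ × ℝ) (u : Fin 2 → ℝ) (i : Fin 2) :
    fderiv ℝ (fun q => connectionForm (X q) (T q)) q h k u i =
      k.1 * ∑ j, fderiv ℝ (fun p => X p i j) q h * u j
        + k.2 * ∑ j, fderiv ℝ (fun p => T p i j) q h * u j := by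
  have hVq := hV.mem_nhds hq
  have hA := (((contDiffOn_connectionForm hX hT).contDiffAt hVq).differentiableAt
    one_ne_zero).hasFDerivAt
  have hX' := fun i j => (((hX i j).contDiffAt hVq).differentiableAt one_ne_zero).hasFDerivAt
  have hT' := fun i j => (((hT i j).contDiffAt hVq).differentiableAt one_ne_zero).hasFDerivAt
  have h1 := hasFDerivAt_pi'.1
    ((hA.clm_apply (hasFDerivAt_const k q)).clm_apply (hasFDerivAt_const u q)) i
  simp only [connectionForm_apply] at h1
  have h2 := ((HasFDerivAt.fun_sum fun j (_ : j ∈ Finset.univ) =>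
      (hX' i j).mul_const (u j)).const_mul k.1).add
    ((HasFDerivAt.fun_sum fun j (_ : j ∈ Finset.univ) =>
      (hT' i j).mul_const (u j)).const_mul k.2)
  simpa [mul_comm, mul_add] using DFunLike.congr_fun (h1.unique h2) h

end MatrixPair

/-- on a convex open domain, the zero-curvature equation implies that the
linear problem `v_x = X v`, `v_t = T v` admits a solution through any initial value. -/
theorem linear_problem_integrable_of_zero_curvature
    (V : Set (ℝ × ℝ)) (hV : IsOpen V) (hVconv : Convex ℝ V)
    (X T : ℝ × ℝ → Matrix (Fin 2) (Fin 2) ℝ)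
    (hX : ∀ i j : Fin 2, ContDiffOn ℝ (⊤ : ℕ∞) (fun p => X p i j) V)
    (hT : ∀ i j : Fin 2, ContDiffOn ℝ (⊤ : ℕ∞) (fun p => T p i j) V)
    (hzc : ∀ p ∈ V, ∀ i j : Fin 2,
      pdt (fun q => X q i j) p - pdx (fun q => T q i j) p
        + (X p * T p - T p * X p) i j = 0) :
    ∀ p ∈ V, ∀ v₀ : Fin 2 → ℝ,
      ∃ v : ℝ × ℝ → (Fin 2 → ℝ),
        ContDiffOn ℝ (⊤ : ℕ∞) v V ∧ v p = v₀ ∧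
        ∀ q ∈ V, ∀ i : Fin 2,
          pdx (fun z => v z i) q = (X q).mulVec (v q) i ∧
          pdt (fun z => v z i) q = (T q).mulVec (v q) i := by
  intro p hp v₀
  have hA := contDiffOn_connectionForm (X := fun q => X q) (T := fun q => T q) hX hT
  have hflat : ∀ q ∈ V, ∀ (h k : ℝ × ℝ) (u : Fin 2 → ℝ),
      fderiv ℝ (fun q => connectionForm (X q) (T q)) q h k u
          + connectionForm (X q) (T q) k (connectionForm (X q) (T q) h u)
        = fderiv ℝ (fun q => connectionForm (X q) (T q)) q k h u
          + connectionForm (X q) (T q) h (connectionForm (X q) (T q) k u) := by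
    intro q hq h k u
    funext i
    have hd := fderiv_connectionForm_apply (X := fun q => X q) (T := fun q => T q) hV
      (fun i j => contDiffOn_infty.1 (hX i j) 1) (fun i j => contDiffOn_infty.1 (hT i j) 1) hq
    have hz0 := hzc q hq i 0
    have hz1 := hzc q hq i 1
    simp only [Matrix.sub_apply, Matrix.mul_apply, Fin.sum_univ_two] at hz0 hz1
    simp only [Pi.add_apply, hd, connectionForm_apply (X q) (T q), fderiv_apply_eq_pd, Fin.sum_univ_two]
    linear_combination (h.2 * k.1 - h.1 * k.2) * (u 0 * hz0 + u 1 * hz1)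
  obtain ⟨v, hvp, hv⟩ := exists_hasFDerivAt_of_flat hV hVconv (contDiffOn_infty.1 hA 1) hflat hp v₀
  refine ⟨v, contDiffOn_of_hasFDerivAt_flip hV hA hv, hvp, fun q hq i => ?_⟩
  have hd : ∀ h, fderiv ℝ (fun z => v z i) q h = connectionForm (X q) (T q) h (v q) i := fun h =>
    DFunLike.congr_fun (hasFDerivAt_pi'.1 (hv q hq) i).fderiv h
  simp [pdx, pdt, hd, connectionForm_apply (X q) (T q), Matrix.mulVec, dotProduct]
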